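/- Under the hypotheses of the preceding setting — E a real Banach space, T > 0, 0 < α₀ < 1, 0 < μ < 1, r ≥ 1, N ≥ 2, the graded mesh t_n = T(n/N)^r with step sizes τ_n, the Peano kernels K(s;θ), the nonuniform L1 weights a^{(n)}_{n−k} with exponent α₀ and the complementary kernels P^{(n)}_{n−k}; v : (0,T] → E twice continuously differentiable with ‖v'(t)‖ ≤ C_v t^{α₀−1}, ‖v''(t)‖ ≤ C_v t^{α₀−2}; 𝒦 : (0,T] → ℝ with |𝒦(t)| ≤ C₀ t^{−μ}; and (R̃₂)ⁿ defined by (R̃₂)¹ = ∫_0^{t₁} 𝒦(t₁ − s)(∫_{t₁}^{s} v'(θ) dθ) ds and (R̃₂)ⁿ = ∫_0^{t₁} 𝒦(t_n − s)(∫_{t₁}^{s} v'(θ) dθ) ds + Σ_{j=2}^{n} ∫_{t_{j−1}}^{t_j} 𝒦(t_n − s)(∫_{t_{j−1}}^{t_j} K(s;θ) v''(θ) dθ) ds for n ≥ 2 — there exists a constant C, independent of N and m, such that Σ_{n=1}^{m} P^{(m)}_{m−n} ‖(R̃₂)ⁿ‖ ≤ C (1 + ln N) N^{−min{r(1+2α₀−μ),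 r(1+α₀), 2}} for every 1 ≤ m ≤ N. -/

import Mathlib

open MeasureTheory intervalIntegral

/-- `β_ν(t) = t^(ν-1)/Γ(ν)`. -/
noncomputable def betaK (ν t : ℝ) : ℝ := t ^ (ν - 1) / Real.Gamma ν

/-- The graded temporal mesh `t_n = T (n/N)^r`. -/
noncomputable def gm (T r : ℝ) (N n : ℕ) : ℝ := T * ((n : ℝ) / (N : ℝ)) ^ r

/-- The Peano kernel of the midpoint-type interpolation quadrature on `[t_{j-1}, t_j]`. -/
noncomputable def peanoK (T r : ℝ) (N j : ℕ) (s θ : ℝ) : ℝ :=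
  if θ ≤ s then
    (θ - gm T r N (j - 1)) * (s - gm T r N j) / (gm T r N j - gm T r N (j - 1))
  else
    (θ - gm T r N j) * (s - gm T r N (j - 1)) / (gm T r N j - gm T r N (j - 1))

/-- The nonuniform L1 weight `a^{(n)}_{n-k}` on the graded mesh. -/
noncomputable def L1w (T r α : ℝ) (N n k : ℕ) : ℝ :=
  (betaK (2 - α) (gm T r N n - gm T r N (k - 1)) - betaK (2 - α) (gm T r N n - gm T r N k)) /
    (gm T r N k - gm T r N (k - 1))

section PowerInequalities

/-- `((t - a)^(1-μ) - (t - b)^(1-μ)) / (1-μ)`, the value of `∫ s in a..b, (t - s)^(-μ)`. -/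
noncomputable def powGap (μ t a b : ℝ) : ℝ := ((t - a) ^ (1 - μ) - (t - b) ^ (1 - μ)) / (1 - μ)

lemma mul_rpow_neg_le_rpow_sub_rpow {p x h : ℝ} (hp0 : 0 ≤ p) (hp1 : p ≤ 1) (hx : 0 < x)
    (hhx : h ≤ x) : p * (h * x ^ (p - 1)) ≤ x ^ p - (x - h) ^ p := by
  have hdiv : h / x ≤ 1 := (div_le_one hx).2 hhx
  have hb := rpow_one_add_le_one_add_mul_self (s := -(h / x)) (by linarith) hp0 hp1
  have hxh : x - h = x * (1 + -(h / x)) := by field_simp; ring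
  rw [hxh, Real.mul_rpow hx.le (by linarith), Real.rpow_sub_one hx.ne']
  have hpos : 0 < x ^ p := Real.rpow_pos_of_pos hx p
  have := mul_le_mul_of_nonneg_left hb hpos.le
  have e : p * (h * (x ^ p / x)) = x ^ p * (p * (h / x)) := by ring
  rw [e]; linarith

lemma rpow_add_sub_rpow_le {p x h : ℝ} (hp0 : 0 ≤ p) (hp1 : p ≤ 1) (hx : 0 < x) (hh : 0 ≤ h) :
    (x + h) ^ p - x ^ p ≤ p * (h * x ^ (p - 1)) := by
  have := mul_rpow_neg_le_rpow_sub_rpow (h := -h) hp0 hp1 hx (by linarith)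
  rw [sub_neg_eq_add] at this
  linarith

lemma rpow_sub_rpow_sub_le {p x h : ℝ} (hp1 : p ≤ 1) (hx : 0 < x) (hh : 0 ≤ h)
    (hhx : h ≤ x) : x ^ p - (x - h) ^ p ≤ h * x ^ (p - 1) := by
  have hdiv : h / x ≤ 1 := (div_le_one hx).2 hhx
  have hdiv0 : 0 ≤ h / x := by positivity
  have hb := Real.self_le_rpow_of_le_one (x := 1 - h / x) (by linarith) (by linarith) hp1
  have hxh : x - h = x * (1 - h / x) := by field_simp
  rw [hxh, Real.mul_rpow hx.le (by linarith), Real.rpow_sub_one hx.ne']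
  have hpos : 0 < x ^ p := Real.rpow_pos_of_pos hx p
  have := mul_le_mul_of_nonneg_left hb hpos.le
  have e : h * (x ^ p / x) = x ^ p * (h / x) := by ring
  rw [e]; linarith

variable {μ t a b : ℝ}

lemma powGap_nonneg (hμ : μ < 1) (hab : a ≤ b) (hbt : b ≤ t) : 0 ≤ powGap μ t a b :=
  div_nonneg (sub_nonneg.2 <| Real.rpow_le_rpow (by linarith) (by linarith) (by linarith))
    (by linarith)

lemma powGap_zero_le (hμ0 : 0 < μ) (hμ : μ < 1) (hb : 0 ≤ b) (hbt : b ≤ t) (ht : 0 < t) :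
    powGap μ t 0 b ≤ b * t ^ (-μ) / (1 - μ) := by
  have := rpow_sub_rpow_sub_le (p := 1 - μ) (by linarith) ht hb hbt
  rw [show 1 - μ - 1 = -μ by ring] at this
  unfold powGap
  rw [sub_zero]
  exact div_le_div_of_nonneg_right this (by linarith)

lemma powGap_div_le (hμ0 : 0 < μ) (hμ : μ < 1) (ha : 0 < a) (hab : a ≤ b) (hbt : b ≤ t) :
    powGap μ t a b * b⁻¹ ≤
      2 * t ^ (-μ) * (Real.log b - Real.log a) + 2 * t⁻¹ * powGap μ t a b := by
  have hb : 0 < b := by linarith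
  have ht : 0 < t := by linarith
  have hgap := powGap_nonneg hμ hab hbt
  have hpow : 0 < t ^ (-μ) := Real.rpow_pos_of_pos ht _
  have hlog : 0 ≤ Real.log b - Real.log a := sub_nonneg.2 (Real.log_le_log ha hab)
  rcases le_total t (2 * b) with h | h
  · have hinv : b⁻¹ ≤ 2 * t⁻¹ := by
      rw [← div_eq_mul_inv, inv_eq_one_div, div_le_div_iff₀ hb ht]; linarith
    have := mul_le_mul_of_nonneg_left hinv hgap
    have : 0 ≤ 2 * t ^ (-μ) * (Real.log b - Real.log a) := by positivity
    linarith
  · have htb : 0 < t - b := by linarith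
    have hgap' : powGap μ t a b ≤ (b - a) * (t - b) ^ (-μ) := by
      have := rpow_add_sub_rpow_le (p := 1 - μ) (by linarith) (by linarith) htb (sub_nonneg.2 hab)
      rw [show 1 - μ - 1 = -μ by ring, show t - b + (b - a) = t - a by ring] at this
      unfold powGap
      rw [div_le_iff₀ (by linarith)]
      linarith
    have htb' : (t - b) ^ (-μ) ≤ 2 * t ^ (-μ) := by
      calc (t - b) ^ (-μ) ≤ (t / 2) ^ (-μ) :=
            Real.rpow_le_rpow_of_nonpos (by linarith) (by linarith) (by linarith)
        _ = 2 ^ μ * t ^ (-μ) := by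
            rw [Real.div_rpow ht.le (by norm_num), Real.rpow_neg (by norm_num : (0:ℝ) ≤ 2)]
            field_simp
        _ ≤ 2 * t ^ (-μ) := by
            gcongr
            exact (Real.rpow_le_rpow_of_exponent_le (by norm_num) hμ.le).trans_eq (Real.rpow_one 2)
    have hdiff : (b - a) * b⁻¹ ≤ Real.log b - Real.log a := by
      have := Real.one_sub_inv_le_log_of_pos (x := b / a) (by positivity)
      rw [Real.log_div hb.ne' ha.ne'] at this
      refine le_trans (le_of_eq ?_) this
      field_simp
    have hba : 0 ≤ (b - a) * b⁻¹ := mul_nonneg (by linarith) (by positivity)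
    calc powGap μ t a b * b⁻¹ ≤ (b - a) * (t - b) ^ (-μ) * b⁻¹ := by gcongr
      _ = (b - a) * b⁻¹ * (t - b) ^ (-μ) := by ring
      _ ≤ (Real.log b - Real.log a) * (2 * t ^ (-μ)) := by gcongr
      _ ≤ _ := by
        have : 0 ≤ 2 * t⁻¹ * powGap μ t a b := by positivity
        linarith

lemma intervalIntegrable_sub_rpow_neg (hμ : μ < 1) :
    IntervalIntegrable (fun s => (t - s) ^ (-μ)) volume a b := by
  have h := (intervalIntegrable_rpow' (a := t - a) (b := t - b) (r := -μ)
    (by linarith)).comp_sub_left t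
  simpa using h

lemma integral_sub_rpow_neg (hμ : μ < 1) : ∫ s in a..b, (t - s) ^ (-μ) = powGap μ t a b := by
  rw [intervalIntegral.integral_comp_sub_left (fun x : ℝ => x ^ (-μ)) t,
    integral_rpow (Or.inl (by linarith)), powGap, show -μ + 1 = 1 - μ by ring]

end PowerInequalities

section WeaklySingularIntegrals

variable {E : Type*} [NormedAddCommGroup E] [NormedSpace ℝ E]

lemma norm_integral_singular_smul_le {μ t a b T C₀ M : ℝ} {K : ℝ → ℝ} {f : ℝ → E} (hμ : μ < 1)
    (ha : 0 ≤ a) (hab : a ≤ b) (hbt : b ≤ t) (htT : t ≤ T)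
    (hK : ∀ s ∈ Set.Ioc (0:ℝ) T, |K s| ≤ C₀ * s ^ (-μ)) (hf : ∀ s ∈ Set.Ioc a b, ‖f s‖ ≤ M) :
    ‖∫ s in a..b, K (t - s) • f s‖ ≤ C₀ * M * powGap μ t a b := by
  rw [← integral_sub_rpow_neg hμ, ← intervalIntegral.integral_const_mul]
  refine intervalIntegral.norm_integral_le_of_norm_le hab ?_
    ((intervalIntegrable_sub_rpow_neg hμ).const_mul _)
  filter_upwards [Measure.ae_ne volume t] with s hst hs
  have hlt : s < t := lt_of_le_of_ne (hs.2.trans hbt) hst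
  have hKs := hK (t - s) ⟨by linarith, by linarith [hs.1]⟩
  rw [norm_smul, Real.norm_eq_abs]
  calc |K (t - s)| * ‖f s‖ ≤ (C₀ * (t - s) ^ (-μ)) * M :=
        mul_le_mul hKs (hf s hs) (norm_nonneg _) ((abs_nonneg _).trans hKs)
    _ = _ := by ring

lemma norm_integral_le_of_norm_le_rpow {α b C T s : ℝ} {f : ℝ → E} (hα : 0 < α) (hC : 0 ≤ C)
    (hbT : b ≤ T) (hf : ∀ s ∈ Set.Ioc (0:ℝ) T, ‖f s‖ ≤ C * s ^ (α - 1))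
    (hs : s ∈ Set.Ioc 0 b) : ‖∫ θ in b..s, f θ‖ ≤ C * b ^ α / α := by
  rw [intervalIntegral.integral_symm, norm_neg]
  have h := intervalIntegral.norm_integral_le_of_norm_le (μ := volume) (f := f)
    (g := fun θ => C * θ ^ (α - 1)) hs.2
    (Filter.Eventually.of_forall fun θ hθ => hf θ ⟨hs.1.trans hθ.1, hθ.2.trans hbT⟩)
    ((intervalIntegrable_rpow' (by linarith)).const_mul _)
  refine h.trans ?_
  rw [intervalIntegral.integral_const_mul, integral_rpow (Or.inl (by linarith)),
    sub_add_cancel, mul_div_assoc]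
  have : 0 ≤ s ^ α := Real.rpow_nonneg hs.1.le _
  gcongr
  linarith

end WeaklySingularIntegrals

section GradedMesh

variable {T r α : ℝ} {N : ℕ}

lemma gm_zero (hr : 1 ≤ r) : gm T r N 0 = 0 := by
  simp [gm, Real.zero_rpow (by linarith : r ≠ 0)]

lemma gm_pos (hT : 0 < T) (hN : 2 ≤ N) {n : ℕ} (hn : 1 ≤ n) : 0 < gm T r N n := by
  have : (0:ℝ) < n := by exact_mod_cast hn
  have : (0:ℝ) < N := by exact_mod_cast (by omega : 0 < N)
  unfold gm; positivity

lemma gm_nonneg (hT : 0 < T) (n : ℕ) : 0 ≤ gm T r N n := by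
  unfold gm; positivity

lemma gm_strictMono (hT : 0 < T) (hr : 1 ≤ r) (hN : 2 ≤ N) : StrictMono (gm T r N) := by
  intro k n hkn
  have : (0:ℝ) < N := by exact_mod_cast (by omega : 0 < N)
  unfold gm
  gcongr

lemma gm_self (hN : 2 ≤ N) : gm T r N N = T := by
  have : (N:ℝ) ≠ 0 := by exact_mod_cast (by omega : N ≠ 0)
  simp [gm, div_self this]

lemma gm_le (hT : 0 < T) (hr : 1 ≤ r) (hN : 2 ≤ N) {n : ℕ} (hn : n ≤ N) : gm T r N n ≤ T :=
  ((gm_strictMono hT hr hN).monotone hn).trans_eq (gm_self hN)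

lemma gm_sub_le (hT : 0 < T) (hr : 1 ≤ r) {j : ℕ} (hj : 1 ≤ j) :
    gm T r N j - gm T r N (j - 1) ≤ r / j * gm T r N j := by
  have hj0 : (0:ℝ) < j := by exact_mod_cast hj
  have hj1 : (1:ℝ) ≤ j := by exact_mod_cast hj
  have hinv : 1 / (j:ℝ) ≤ 1 := (div_le_one hj0).2 hj1
  have hb := one_add_mul_self_le_rpow_one_add (s := -(1 / (j:ℝ))) (by linarith) hr
  have e : gm T r N (j - 1) = gm T r N j * (1 + -(1 / (j:ℝ))) ^ r := by
    unfold gm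
    rw [mul_assoc, ← Real.mul_rpow (by positivity) (by linarith), Nat.cast_sub hj, Nat.cast_one]
    congr 2
    field_simp
    ring
  have := mul_le_mul_of_nonneg_left hb (gm_nonneg (r := r) (N := N) hT j)
  have e2 : r / j * gm T r N j = gm T r N j * (r * (1 / j)) := by ring
  rw [e, e2]; linarith

lemma gm_le_two_rpow_mul (hT : 0 < T) (hr : 1 ≤ r) {j : ℕ} (hj : 2 ≤ j) :
    gm T r N j ≤ 2 ^ r * gm T r N (j - 1) := by
  have hj' : (j:ℝ) ≤ 2 * ((j - 1 : ℕ) : ℝ) := by exact_mod_cast (by omega : j ≤ 2 * (j - 1))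
  unfold gm
  rw [mul_left_comm, ← Real.mul_rpow (by norm_num) (by positivity), ← mul_div_assoc]
  gcongr

lemma log_gm_sub_log_gm_one_le (hT : 0 < T) (hr : 1 ≤ r) (hN : 2 ≤ N) {n : ℕ} (hn1 : 1 ≤ n)
    (hn : n ≤ N) : Real.log (gm T r N n) - Real.log (gm T r N 1) ≤ r * Real.log N := by
  have hN0 : (0:ℝ) < N := by exact_mod_cast (by omega : 0 < N)
  have h := Real.log_le_log (gm_pos (r := r) hT hN hn1) (gm_le hT hr hN hn)
  have h1 : Real.log (gm T r N 1) = Real.log T - r * Real.log N := by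
    unfold gm
    rw [Real.log_mul hT.ne' (by positivity), Real.log_rpow (by positivity), Nat.cast_one,
      one_div, Real.log_inv]
    ring
  linarith

lemma sq_inv_mul_gm_rpow_le {γ : ℝ} (hT : 0 < T) (hr : 1 ≤ r) (hN : 2 ≤ N) (hγ2 : γ ≤ 2)
    (hγ : γ ≤ r * (1 + α)) {j n : ℕ} (hj : 1 ≤ j) (hjn : j ≤ n) :
    ((j:ℝ) ^ 2)⁻¹ * gm T r N j ^ (1 + α) ≤
      T ^ (γ / r) * (N:ℝ) ^ (-γ) * gm T r N n ^ (1 + α - γ / r) := by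
  have hr0 : 0 < r := by linarith
  have hj0 : (0:ℝ) < j := by exact_mod_cast hj
  have hj1 : (1:ℝ) ≤ j := by exact_mod_cast hj
  have hN0 : (0:ℝ) < N := by exact_mod_cast (by omega : 0 < N)
  have hg := gm_pos (r := r) hT hN hj
  have hq : 0 ≤ 1 + α - γ / r := by
    rw [sub_nonneg, div_le_iff₀ hr0]; linarith
  have e1 : gm T r N j ^ (1 + α) = gm T r N j ^ (γ / r) * gm T r N j ^ (1 + α - γ / r) := by
    rw [← Real.rpow_add hg]; congr 1; ring
  have e2 : gm T r N j ^ (γ / r) = T ^ (γ / r) * ((N:ℝ) ^ (-γ) * (j:ℝ) ^ γ) := by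
    unfold gm
    rw [Real.mul_rpow hT.le (by positivity), ← Real.rpow_mul (by positivity),
      mul_div_cancel₀ _ hr0.ne', Real.div_rpow hj0.le hN0.le, Real.rpow_neg hN0.le]
    ring
  have hjγ : ((j:ℝ) ^ 2)⁻¹ * (j:ℝ) ^ γ ≤ 1 := by
    rw [inv_mul_le_iff₀ (by positivity), mul_one, ← Real.rpow_natCast]
    exact Real.rpow_le_rpow_of_exponent_le hj1 (by exact_mod_cast hγ2)
  calc ((j:ℝ) ^ 2)⁻¹ * gm T r N j ^ (1 + α)
      = (((j:ℝ) ^ 2)⁻¹ * (j:ℝ) ^ γ) *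
          (T ^ (γ / r) * (N:ℝ) ^ (-γ) * gm T r N j ^ (1 + α - γ / r)) := by rw [e1, e2]; ring
    _ ≤ 1 * (T ^ (γ / r) * (N:ℝ) ^ (-γ) * gm T r N n ^ (1 + α - γ / r)) := by
        gcongr
        exact (gm_strictMono hT hr hN).monotone hjn
    _ = _ := one_mul _

end GradedMesh

section ComplementaryKernel

variable {N : ℕ} {a P : ℕ → ℕ → ℝ}

lemma complementary_kernel_nonneg
    (hdiag : ∀ k, 1 ≤ k → k ≤ N → 0 < a k k)
    (hmono : ∀ j k, 1 ≤ k → k + 1 ≤ j → j ≤ N → a j k ≤ a j (k + 1))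
    (hP0 : ∀ n : ℕ, 1 ≤ n → n ≤ N → P n 0 = 1 / a n n)
    (hP : ∀ n k : ℕ, 1 ≤ k → k + 1 ≤ n → n ≤ N →
      P n (n - k) = (1 / a k k) * ∑ j ∈ Finset.Icc (k + 1) n, (a j (k + 1) - a j k) * P n (n - j))
    {n : ℕ} (hn : n ≤ N) (i : ℕ) : i < n → 0 ≤ P n i := by
  induction i using Nat.strong_induction_on with
  | _ i ih =>
    intro hi
    rcases Nat.eq_zero_or_pos i with rfl | hi0
    · rw [hP0 n hi hn]
      exact (one_div_pos.2 (hdiag n hi hn)).le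
    · have h := hP n (n - i) (by omega) (by omega) hn
      rw [show n - (n - i) = i by omega] at h
      rw [h]
      refine mul_nonneg (one_div_pos.2 (hdiag _ (by omega) (by omega))).le
        (Finset.sum_nonneg fun j hj => ?_)
      rw [Finset.mem_Icc] at hj
      exact mul_nonneg (sub_nonneg.2 (hmono j (n - i) (by omega) (by omega) (by omega)))
        (ih (n - j) (by omega) (by omega))

lemma sum_complementary_kernel_mul
    (hdiag : ∀ k, 1 ≤ k → k ≤ N → 0 < a k k)
    (hP0 : ∀ n : ℕ, 1 ≤ n → n ≤ N → P n 0 = 1 / a n n)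
    (hP : ∀ n k : ℕ, 1 ≤ k → k + 1 ≤ n → n ≤ N →
      P n (n - k) = (1 / a k k) * ∑ j ∈ Finset.Icc (k + 1) n, (a j (k + 1) - a j k) * P n (n - j))
    {n k : ℕ} (hk : 1 ≤ k) (hkn : k ≤ n) (hn : n ≤ N) :
    ∑ j ∈ Finset.Icc k n, P n (n - j) * a j k = 1 := by
  induction hkn using Nat.decreasingInduction with
  | self =>
    rw [Finset.Icc_self, Finset.sum_singleton, Nat.sub_self, hP0 n hk hn]
    exact one_div_mul_cancel (hdiag n hk hn).ne'
  | of_succ k hkn ih =>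
    rw [← ih (by omega), ← Finset.add_sum_Ioc_eq_sum_Icc hkn.le, ← Finset.Icc_add_one_left_eq_Ioc,
      hP n k hk hkn hn, one_div_mul_eq_div, div_mul_cancel₀ _ (hdiag k hk (by omega)).ne',
      ← Finset.sum_add_distrib]
    exact Finset.sum_congr rfl fun j _ => by ring

end ComplementaryKernel

section L1Weights

variable {T r α : ℝ} {N : ℕ}

lemma L1w_mono (hT : 0 < T) (h0 : 0 < α) (h1 : α < 1) (hr : 1 ≤ r) (hN : 2 ≤ N) {j k : ℕ}
    (hk : 1 ≤ k) (hkj : k + 1 ≤ j) : L1w T r α N j k ≤ L1w T r α N j (k + 1) := by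
  have hm := gm_strictMono hT hr hN
  have hab : gm T r N (k - 1) < gm T r N k := hm (by omega)
  have hbc : gm T r N k < gm T r N (k + 1) := hm (by omega)
  have hcj : gm T r N (k + 1) ≤ gm T r N j := hm.monotone hkj
  have hΓ : 0 < Real.Gamma (2 - α) := Real.Gamma_pos_of_pos (by linarith)
  have h := (Real.concaveOn_rpow (p := 2 - α - 1) (by linarith) (by linarith)).slope_anti_adjacent
    (x := gm T r N j - gm T r N (k + 1)) (y := gm T r N j - gm T r N k)
    (z := gm T r N j - gm T r N (k - 1)) (by simp; linarith) (by simp; linarith)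
    (by linarith) (by linarith)
  rw [sub_sub_sub_cancel_left, sub_sub_sub_cancel_left] at h
  unfold L1w betaK
  rw [Nat.add_sub_cancel, ← sub_div, ← sub_div, div_right_comm, div_right_comm _ (Real.Gamma _)]
  exact div_le_div_of_nonneg_right h hΓ.le

lemma L1w_self_pos (hT : 0 < T) (h1 : α < 1) (hr : 1 ≤ r) (hN : 2 ≤ N) {k : ℕ}
    (hk : 1 ≤ k) : 0 < L1w T r α N k k := by
  have hab : gm T r N (k - 1) < gm T r N k := gm_strictMono hT hr hN (by omega)
  have hΓ : 0 < Real.Gamma (2 - α) := Real.Gamma_pos_of_pos (by linarith)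
  unfold L1w betaK
  rw [sub_self, Real.zero_rpow (by linarith : 2 - α - 1 ≠ 0), zero_div, sub_zero]
  have : 0 < gm T r N k - gm T r N (k - 1) := by linarith
  positivity

lemma rpow_neg_le_L1w_one (hT : 0 < T) (h0 : 0 < α) (h1 : α < 1) (hr : 1 ≤ r) (hN : 2 ≤ N) {n : ℕ}
    (hn : 1 ≤ n) :
    gm T r N n ^ (-α) ≤ Real.Gamma (2 - α) / (1 - α) * L1w T r α N n 1 := by
  have hΓ : 0 < Real.Gamma (2 - α) := Real.Gamma_pos_of_pos (by linarith)
  have h1α : 0 < 1 - α := by linarith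
  have ht1 : 0 < gm T r N 1 := gm_pos hT hN le_rfl
  have h := mul_rpow_neg_le_rpow_sub_rpow (p := 1 - α) (x := gm T r N n) (h := gm T r N 1)
    h1α.le (by linarith) (gm_pos hT hN hn) ((gm_strictMono hT hr hN).monotone hn)
  rw [show 1 - α - 1 = -α by ring] at h
  unfold L1w betaK
  rw [Nat.sub_self, gm_zero hr, sub_zero, sub_zero, show 2 - α - 1 = 1 - α by ring, ← sub_div,
    div_right_comm _ (Real.Gamma _), div_mul_div_comm, mul_comm,
    mul_div_mul_right _ _ hΓ.ne', le_div_iff₀ h1α, le_div_iff₀ ht1]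
  linarith

end L1Weights

section Truncation

variable {E : Type*} [NormedAddCommGroup E] [NormedSpace ℝ E]
  {T r α : ℝ} {N : ℕ}

lemma abs_peanoK_le {j : ℕ} {s θ : ℝ} (hab : gm T r N (j - 1) < gm T r N j)
    (hs : s ∈ Set.Icc (gm T r N (j - 1)) (gm T r N j))
    (hθ : θ ∈ Set.Icc (gm T r N (j - 1)) (gm T r N j)) :
    |peanoK T r N j s θ| ≤ gm T r N j - gm T r N (j - 1) := by
  obtain ⟨hs1, hs2⟩ := hs
  obtain ⟨hθ1, hθ2⟩ := hθ
  have hpos : 0 < gm T r N j - gm T r N (j - 1) := by linarith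
  unfold peanoK
  split_ifs
  all_goals
    rw [abs_div, abs_of_pos hpos, div_le_iff₀ hpos, abs_mul]
    exact mul_le_mul (abs_le.2 ⟨by linarith, by linarith⟩) (abs_le.2 ⟨by linarith, by linarith⟩)
      (abs_nonneg _) hpos.le

lemma norm_integral_peanoK_smul_le {C : ℝ} {f : ℝ → E} (hT : 0 < T) (h1 : α < 1) (hr : 1 ≤ r)
    (hN : 2 ≤ N) (hC : 0 ≤ C) (hf : ∀ s ∈ Set.Ioc (0:ℝ) T, ‖f s‖ ≤ C * s ^ (α - 2))
    {j : ℕ} (hj : 2 ≤ j) (hjN : j ≤ N) {s : ℝ}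
    (hs : s ∈ Set.Ioc (gm T r N (j - 1)) (gm T r N j)) :
    ‖∫ θ in gm T r N (j - 1)..gm T r N j, peanoK T r N j s θ • f θ‖ ≤
      C * r ^ 2 * (2 ^ r) ^ (2 - α) * (((j:ℝ) ^ 2)⁻¹ * gm T r N j ^ (1 + α)) *
        (gm T r N j)⁻¹ := by
  have ha : 0 < gm T r N (j - 1) := gm_pos hT hN (by omega)
  have hab : gm T r N (j - 1) < gm T r N j := gm_strictMono hT hr hN (by omega)
  have hbT : gm T r N j ≤ T := gm_le hT hr hN hjN
  have hstep : gm T r N j - gm T r N (j - 1) ≤ r / j * gm T r N j := gm_sub_le hT hr (by omega)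
  have hratio := gm_le_two_rpow_mul (r := r) (N := N) hT hr hj
  set a := gm T r N (j - 1) with ha_def
  set b := gm T r N j with hb_def
  have hb : 0 < b := ha.trans hab
  have hpow : a ^ (α - 2) ≤ (2 ^ r) ^ (2 - α) * b ^ (α - 2) := by
    calc a ^ (α - 2) ≤ (b / 2 ^ r) ^ (α - 2) :=
          Real.rpow_le_rpow_of_nonpos (by positivity)
            ((div_le_iff₀' (by positivity)).2 hratio) (by linarith)
      _ = _ := by
          rw [Real.div_rpow hb.le (by positivity), show 2 - α = -(α - 2) by ring,
            Real.rpow_neg (by positivity : (0:ℝ) ≤ 2 ^ r)]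
          ring
  have hint : ‖∫ θ in a..b, peanoK T r N j s θ • f θ‖ ≤
      (b - a) * (C * a ^ (α - 2)) * |b - a| := by
    refine intervalIntegral.norm_integral_le_of_norm_le_const fun θ hθ => ?_
    rw [Set.uIoc_of_le hab.le] at hθ
    rw [norm_smul, Real.norm_eq_abs]
    refine mul_le_mul (abs_peanoK_le hab ⟨hs.1.le, hs.2⟩ ⟨hθ.1.le, hθ.2⟩) ?_ (norm_nonneg _)
      (by linarith)
    refine (hf θ ⟨ha.trans hθ.1, hθ.2.trans hbT⟩).trans ?_
    exact mul_le_mul_of_nonneg_left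
      (Real.rpow_le_rpow_of_nonpos ha hθ.1.le (by linarith)) hC
  have hba : 0 ≤ b - a := by linarith
  have e : b ^ (1 + α) = b ^ (α - 2) * b ^ 3 := by
    rw [← Real.rpow_natCast, ← Real.rpow_add hb]; congr 1; push_cast; ring
  refine hint.trans ?_
  rw [abs_of_nonneg hba]
  calc (b - a) * (C * a ^ (α - 2)) * (b - a)
      ≤ (r / j * b) * (C * ((2 ^ r) ^ (2 - α) * b ^ (α - 2))) * (r / j * b) := by gcongr
    _ = _ := by rw [e]; field_simp

/-- The local truncation error decays like `N^(-γ) t_n^(-α)`, up to a logarithmic factor. -/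
lemma norm_truncation_le {μ Cv C₀ γ : ℝ} {v' v'' : ℝ → E} {K : ℝ → ℝ} (hT : 0 < T) (h0 : 0 < α)
    (h1 : α < 1) (hμ0 : 0 < μ) (hμ1 : μ < 1) (hr : 1 ≤ r) (hN : 2 ≤ N) (hCv : 0 ≤ Cv)
    (hC₀ : 0 ≤ C₀) (hγ2 : γ ≤ 2) (hγ : γ ≤ r * (1 + α)) (hγμ : γ ≤ r * (1 + 2 * α - μ))
    (hv' : ∀ s ∈ Set.Ioc (0:ℝ) T, ‖v' s‖ ≤ Cv * s ^ (α - 1))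
    (hv'' : ∀ s ∈ Set.Ioc (0:ℝ) T, ‖v'' s‖ ≤ Cv * s ^ (α - 2))
    (hK : ∀ s ∈ Set.Ioc (0:ℝ) T, |K s| ≤ C₀ * s ^ (-μ)) {n : ℕ} (hn1 : 1 ≤ n) (hn : n ≤ N) :
    ‖(∫ s in (0:ℝ)..gm T r N 1, K (gm T r N n - s) • (∫ θ in (gm T r N 1)..s, v' θ)) +
        ∑ j ∈ Finset.Icc 2 n,
          ∫ s in gm T r N (j - 1)..gm T r N j, K (gm T r N n - s) •
            (∫ θ in gm T r N (j - 1)..gm T r N j, peanoK T r N j s θ • v'' θ)‖ ≤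
      C₀ * (Cv / (α * (1 - μ)) + 2 * (Cv * r ^ 2 * (2 ^ r) ^ (2 - α)) * (r + 1 / (1 - μ))) *
        T ^ (γ / r) * T ^ (1 + 2 * α - μ - γ / r) *
        ((1 + Real.log N) * (N:ℝ) ^ (-γ)) * gm T r N n ^ (-α) := by
  have hr0 : 0 < r := by linarith
  have hμ' : 0 < 1 - μ := by linarith
  have hm := gm_strictMono (T := T) hT hr hN
  have ht1 : 0 < gm T r N 1 := gm_pos hT hN le_rfl
  have htn : 0 < gm T r N n := gm_pos hT hN hn1
  have htT : gm T r N n ≤ T := gm_le hT hr hN hn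
  have ht1n : gm T r N 1 ≤ gm T r N n := hm.monotone hn1
  have hlogN : 0 ≤ Real.log N := Real.log_nonneg (by exact_mod_cast (by omega : 1 ≤ N))
  have hq : 0 ≤ 1 + 2 * α - μ - γ / r := by
    rw [sub_nonneg, div_le_iff₀ hr0]; linarith
  set t := gm T r N n with ht
  set D := Cv * r ^ 2 * (2 ^ r) ^ (2 - α) with hD
  have hD0 : 0 ≤ D := by positivity
  set W := T ^ (γ / r) * (N:ℝ) ^ (-γ) * t ^ (1 + α - γ / r) with hW
  have hW0 : 0 ≤ W := by positivity
  have hweight : ∀ j, 1 ≤ j → j ≤ n → ((j:ℝ) ^ 2)⁻¹ * gm T r N j ^ (1 + α) ≤ W :=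
    fun j hj hjn => sq_inv_mul_gm_rpow_le hT hr hN hγ2 hγ hj hjn
  have htpos : 0 < t ^ (-μ) := Real.rpow_pos_of_pos htn _
  have hfirst : ‖∫ s in (0:ℝ)..gm T r N 1, K (t - s) • (∫ θ in (gm T r N 1)..s, v' θ)‖ ≤
      C₀ * (Cv / (α * (1 - μ))) * W * t ^ (-μ) := by
    refine (norm_integral_singular_smul_le hμ1 le_rfl ht1.le ht1n htT hK fun s hs =>
      norm_integral_le_of_norm_le_rpow h0 hCv (ht1n.trans htT) hv' hs).trans ?_
    have hw := hweight 1 le_rfl hn1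
    rw [Nat.cast_one, one_pow, inv_one, one_mul, Real.rpow_add ht1, Real.rpow_one] at hw
    calc C₀ * (Cv * gm T r N 1 ^ α / α) * powGap μ t 0 (gm T r N 1)
        ≤ C₀ * (Cv * gm T r N 1 ^ α / α) * (gm T r N 1 * t ^ (-μ) / (1 - μ)) := by
          gcongr
          exact powGap_zero_le hμ0 hμ1 ht1.le ht1n htn
      _ = C₀ * (Cv / (α * (1 - μ))) * (gm T r N 1 * gm T r N 1 ^ α) * t ^ (-μ) := by
          field_simp
      _ ≤ _ := by gcongr
  have hterm : ∀ j ∈ Finset.Icc 2 n,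
      ‖∫ s in gm T r N (j - 1)..gm T r N j, K (t - s) •
        (∫ θ in gm T r N (j - 1)..gm T r N j, peanoK T r N j s θ • v'' θ)‖ ≤
      C₀ * D * W * (2 * t ^ (-μ) * (Real.log (gm T r N j) - Real.log (gm T r N (j - 1))) +
        2 * t⁻¹ * powGap μ t (gm T r N (j - 1)) (gm T r N j)) := by
    intro j hj
    rw [Finset.mem_Icc] at hj
    have ha : 0 < gm T r N (j - 1) := gm_pos hT hN (by omega)
    have hab : gm T r N (j - 1) ≤ gm T r N j := hm.monotone (by omega)
    have hb : 0 < gm T r N j := ha.trans_le hab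
    have hbt : gm T r N j ≤ t := hm.monotone hj.2
    have hgap := powGap_nonneg hμ1 hab hbt
    refine (norm_integral_singular_smul_le hμ1 ha.le hab hbt htT hK fun s hs =>
      norm_integral_peanoK_smul_le hT h1 hr hN hCv hv'' hj.1 (hj.2.trans hn) hs).trans ?_
    calc C₀ * (D * (((j:ℝ) ^ 2)⁻¹ * gm T r N j ^ (1 + α)) * (gm T r N j)⁻¹) *
          powGap μ t (gm T r N (j - 1)) (gm T r N j)
        ≤ C₀ * (D * W * (gm T r N j)⁻¹) * powGap μ t (gm T r N (j - 1)) (gm T r N j) := by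
          gcongr
          exact hweight j (by omega) hj.2
      _ = C₀ * D * W * (powGap μ t (gm T r N (j - 1)) (gm T r N j) * (gm T r N j)⁻¹) := by ring
      _ ≤ _ := by
          gcongr
          exact powGap_div_le hμ0 hμ1 ha hab hbt
  have htele : ∀ k, 1 ≤ k → ∑ j ∈ Finset.Icc 2 k,
      (2 * t ^ (-μ) * (Real.log (gm T r N j) - Real.log (gm T r N (j - 1))) +
        2 * t⁻¹ * powGap μ t (gm T r N (j - 1)) (gm T r N j)) =
      2 * t ^ (-μ) * (Real.log (gm T r N k) - Real.log (gm T r N 1)) +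
        2 * t⁻¹ * powGap μ t (gm T r N 1) (gm T r N k) := by
    intro k hk
    induction k, hk using Nat.le_induction with
    | base => simp [powGap]
    | succ k hk ih =>
      rw [Finset.sum_Icc_succ_top (by omega), ih, Nat.add_sub_cancel]
      unfold powGap
      ring
  have hgap : 2 * t⁻¹ * powGap μ t (gm T r N 1) t ≤ 2 * t ^ (-μ) * (1 / (1 - μ)) := by
    have h : (t - gm T r N 1) ^ (1 - μ) ≤ t ^ (1 - μ) :=
      Real.rpow_le_rpow (by linarith) (by linarith) hμ'.le
    have e : t ^ (1 - μ) = t * t ^ (-μ) := by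
      rw [sub_eq_add_neg, Real.rpow_add htn, Real.rpow_one]
    unfold powGap
    rw [sub_self, Real.zero_rpow hμ'.ne', sub_zero]
    calc 2 * t⁻¹ * ((t - gm T r N 1) ^ (1 - μ) / (1 - μ))
        ≤ 2 * t⁻¹ * (t * t ^ (-μ) / (1 - μ)) := by rw [← e]; gcongr
      _ = _ := by field_simp
  have hsum : ‖∑ j ∈ Finset.Icc 2 n, ∫ s in gm T r N (j - 1)..gm T r N j, K (t - s) •
        (∫ θ in gm T r N (j - 1)..gm T r N j, peanoK T r N j s θ • v'' θ)‖ ≤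
      C₀ * D * W * (2 * t ^ (-μ) * (r * Real.log N) + 2 * t ^ (-μ) * (1 / (1 - μ))) := by
    refine (norm_sum_le_of_le _ hterm).trans ?_
    rw [← Finset.mul_sum, htele n hn1]
    have := log_gm_sub_log_gm_one_le (r := r) hT hr hN hn1 hn
    gcongr
  have hWt : W * t ^ (-μ) ≤
      T ^ (γ / r) * (N:ℝ) ^ (-γ) * (T ^ (1 + 2 * α - μ - γ / r) * t ^ (-α)) := by
    have e : t ^ (1 + α - γ / r) * t ^ (-μ) = t ^ (1 + 2 * α - μ - γ / r) * t ^ (-α) := by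
      rw [← Real.rpow_add htn, ← Real.rpow_add htn]; congr 1; ring
    rw [hW, mul_assoc, e]
    gcongr
  have hcoef : C₀ * (Cv / (α * (1 - μ))) + C₀ * D * (2 * (r * Real.log N) + 2 * (1 / (1 - μ))) ≤
      C₀ * (Cv / (α * (1 - μ)) + 2 * D * (r + 1 / (1 - μ))) * (1 + Real.log N) := by
    have hA : 0 ≤ C₀ * (Cv / (α * (1 - μ))) * Real.log N := by positivity
    have hB : 0 ≤ C₀ * D * 2 * r := by positivity
    have hG : 0 ≤ C₀ * D * 2 * (1 / (1 - μ)) * Real.log N := by positivity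
    linarith
  calc _ ≤ C₀ * (Cv / (α * (1 - μ))) * W * t ^ (-μ) +
        C₀ * D * W * (2 * t ^ (-μ) * (r * Real.log N) + 2 * t ^ (-μ) * (1 / (1 - μ))) :=
        norm_add_le_of_le hfirst hsum
    _ = (C₀ * (Cv / (α * (1 - μ))) + C₀ * D * (2 * (r * Real.log N) + 2 * (1 / (1 - μ)))) *
        (W * t ^ (-μ)) := by ring
    _ ≤ (C₀ * (Cv / (α * (1 - μ)) + 2 * D * (r + 1 / (1 - μ))) * (1 + Real.log N)) *
        (T ^ (γ / r) * (N:ℝ) ^ (-γ) * (T ^ (1 + 2 * α - μ - γ / r) * t ^ (-α))) := by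
        gcongr
    _ = _ := by ring

end Truncation

theorem stmt_16 (T α₀ μ r Cv C₀ : ℝ) (hT : 0 < T) (h0 : 0 < α₀) (h1 : α₀ < 1)
    (hμ0 : 0 < μ) (hμ1 : μ < 1) (hr : 1 ≤ r) :
    ∃ C > 0, ∀ (E : Type) [NormedAddCommGroup E] [NormedSpace ℝ E] [CompleteSpace E],
      ∀ N : ℕ, 2 ≤ N →
      ∀ P : ℕ → ℕ → ℝ,
        (∀ n : ℕ, 1 ≤ n → n ≤ N → P n 0 = 1 / L1w T r α₀ N n n) →
        (∀ n k : ℕ, 1 ≤ k → k + 1 ≤ n → n ≤ N →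
          P n (n - k) = (1 / L1w T r α₀ N k k) *
            ∑ j ∈ Finset.Icc (k + 1) n,
              (L1w T r α₀ N j (k + 1) - L1w T r α₀ N j k) * P n (n - j)) →
      ∀ (v v' v'' : ℝ → E) (K : ℝ → ℝ),
        (∀ s ∈ Set.Ioc (0:ℝ) T, HasDerivAt v (v' s) s) →
        (∀ s ∈ Set.Ioc (0:ℝ) T, HasDerivAt v' (v'' s) s) →
        ContinuousOn v'' (Set.Ioc 0 T) →
        (∀ s ∈ Set.Ioc (0:ℝ) T, ‖v' s‖ ≤ Cv * s ^ (α₀ - 1)) →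
        (∀ s ∈ Set.Ioc (0:ℝ) T, ‖v'' s‖ ≤ Cv * s ^ (α₀ - 2)) →
        Measurable K →
        (∀ s ∈ Set.Ioc (0:ℝ) T, |K s| ≤ C₀ * s ^ (-μ)) →
        ∀ m : ℕ, 1 ≤ m → m ≤ N →
          ∑ n ∈ Finset.Icc 1 m, P m (m - n) *
            ‖(∫ s in (0:ℝ)..gm T r N 1, K (gm T r N n - s) • (∫ θ in (gm T r N 1)..s, v' θ)) +
                ∑ j ∈ Finset.Icc 2 n,
                  ∫ s in gm T r N (j - 1)..gm T r N j, K (gm T r N n - s) •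
                    (∫ θ in gm T r N (j - 1)..gm T r N j, peanoK T r N j s θ • v'' θ)‖ ≤
            C * (1 + Real.log (N : ℝ)) *
              (N : ℝ) ^ (-(min (r * (1 + 2 * α₀ - μ)) (min (r * (1 + α₀)) 2))) := by
  set γ := min (r * (1 + 2 * α₀ - μ)) (min (r * (1 + α₀)) 2) with hγ_def
  set B := C₀ * (Cv / (α₀ * (1 - μ)) +
    2 * (Cv * r ^ 2 * (2 ^ r) ^ (2 - α₀)) * (r + 1 / (1 - μ))) *
      T ^ (γ / r) * T ^ (1 + 2 * α₀ - μ - γ / r) with hB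
  set G := Real.Gamma (2 - α₀) / (1 - α₀) with hG_def
  refine ⟨|B * G| + 1, by positivity, ?_⟩
  intro E _ _ _ N hN P hP0 hP v v' v'' K _ _ _ hv' hv'' _ hK m hm1 hm
  have hTmem : T ∈ Set.Ioc 0 T := ⟨hT, le_rfl⟩
  have hCv : 0 ≤ Cv := nonneg_of_mul_nonneg_left ((norm_nonneg _).trans (hv' T hTmem))
    (Real.rpow_pos_of_pos hT _)
  have hC₀ : 0 ≤ C₀ := nonneg_of_mul_nonneg_left ((abs_nonneg _).trans (hK T hTmem))
    (Real.rpow_pos_of_pos hT _)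
  have hlogN : 0 ≤ Real.log N := Real.log_nonneg (by exact_mod_cast (by omega : 1 ≤ N))
  set L := (1 + Real.log N) * (N:ℝ) ^ (-γ) with hL
  have hL0 : 0 ≤ L := by positivity
  have hμ' : 0 < 1 - μ := by linarith
  have hB0 : 0 ≤ B := by positivity
  have hdiag : ∀ k, 1 ≤ k → k ≤ N → 0 < L1w T r α₀ N k k :=
    fun k hk _ => L1w_self_pos hT h1 hr hN hk
  have hmono : ∀ j k, 1 ≤ k → k + 1 ≤ j → j ≤ N → L1w T r α₀ N j k ≤ L1w T r α₀ N j (k + 1) :=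
    fun j k hk hkj _ => L1w_mono hT h0 h1 hr hN hk hkj
  calc _ ≤ ∑ n ∈ Finset.Icc 1 m, P m (m - n) * (B * L * (G * L1w T r α₀ N n 1)) := by
        refine Finset.sum_le_sum fun n hn => ?_
        rw [Finset.mem_Icc] at hn
        refine mul_le_mul_of_nonneg_left ?_
          (complementary_kernel_nonneg hdiag hmono hP0 hP hm (m - n) (by omega))
        refine (norm_truncation_le hT h0 h1 hμ0 hμ1 hr hN hCv hC₀
          ((min_le_right _ _).trans (min_le_right _ _))
          ((min_le_right _ _).trans (min_le_left _ _)) (min_le_left _ _) hv' hv'' hK hn.1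
          (hn.2.trans hm)).trans ?_
        exact mul_le_mul_of_nonneg_left (rpow_neg_le_L1w_one hT h0 h1 hr hN hn.1)
          (mul_nonneg hB0 hL0)
    _ = B * G * L * ∑ n ∈ Finset.Icc 1 m, P m (m - n) * L1w T r α₀ N n 1 := by
        rw [Finset.mul_sum]
        exact Finset.sum_congr rfl fun n _ => by ring
    _ = B * G * L := by rw [sum_complementary_kernel_mul hdiag hP0 hP le_rfl hm1 hm, mul_one]
    _ ≤ (|B * G| + 1) * L := by
        gcongr
        linarith [le_abs_self (B * G)]
    _ = _ := (mul_assoc _ _ _).symm
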